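/- arXiv:1701.03778 — 2 statements merged into one kernel-verified Lean document; each statement's English description precedes it below -/
import Mathlib

section
/- Let T = (T, m, e) be a Kock-Zöberlein monad on an order-enriched category C, let (X, α) and (Y, β) be Eilenberg–Moore T-algebras (so α ∘ e_X = id_X, α ⊣ e_X, and similarly for β), and let f : X → Y be a morphism of C that is a left adjoint (there exists g : Y → X with f ⊣ g). Then f is a T-algebra homomorphism, i.e., β ∘ T(f) = f ∘ α. -/
open CategoryTheory

universe v u

/-- An order-enrichment of a category: a partial order on every hom-set such that
composition is monotone in both variables. -/
structure OrderEnrichment (C : Type u) [Category.{v} C] where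
  le : ∀ {X Y : C}, (X ⟶ Y) → (X ⟶ Y) → Prop
  le_refl : ∀ {X Y : C} (f : X ⟶ Y), le f f
  le_trans : ∀ {X Y : C} {f g h : X ⟶ Y}, le f g → le g h → le f h
  le_antisymm : ∀ {X Y : C} {f g : X ⟶ Y}, le f g → le g f → f = g
  comp_le_comp_right : ∀ {X Y Z : C} {f g : X ⟶ Y} (h : Y ⟶ Z), le f g → le (f ≫ h) (g ≫ h)
  comp_le_comp_left : ∀ {X Y Z : C} (h : X ⟶ Y) {f g : Y ⟶ Z}, le f g → le (h ≫ f) (h ≫ g)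

/-- The structure morphism of an algebra for a Kock-Zöberlein monad is left adjoint to the unit;
this is the nontrivial inequality. -/
theorem OrderEnrichment.id_le_comp_unit {C : Type u} [Category.{v} C] (E : OrderEnrichment C)
    (T : Monad C) (hKZ : ∀ X : C, E.le (T.map (T.η.app X)) (T.η.app (T.obj X)))
    {X : C} {α : T.obj X ⟶ X} (hα : T.η.app X ≫ α = 𝟙 X) :
    E.le (𝟙 (T.obj X)) (α ≫ T.η.app X) := by
  have h := E.comp_le_comp_right (T.map α) (hKZ X)
  have hnat : α ≫ T.η.app X = T.η.app (T.obj X) ≫ T.map α := T.η.naturality α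
  have hid : T.map (T.η.app X) ≫ T.map α = 𝟙 (T.obj X) := by
    rw [← T.map_comp, hα]
    exact T.map_id X
  rwa [hid, ← hnat] at h

/-- Every morphism between algebras for a Kock-Zöberlein monad is a lax homomorphism. -/
theorem OrderEnrichment.map_comp_le_comp {C : Type u} [Category.{v} C] (E : OrderEnrichment C)
    (T : Monad C) (hKZ : ∀ X : C, E.le (T.map (T.η.app X)) (T.η.app (T.obj X)))
    {X Y : C} {α : T.obj X ⟶ X} {β : T.obj Y ⟶ Y} (hα : T.η.app X ≫ α = 𝟙 X)
    (hβ : T.η.app Y ≫ β = 𝟙 Y) (f : X ⟶ Y) :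
    E.le (T.map f ≫ β) (α ≫ f) := by
  have h := E.comp_le_comp_right (T.map f ≫ β) (E.id_le_comp_unit T hKZ hα)
  have hnat : f ≫ T.η.app Y = T.η.app X ≫ T.map f := T.η.naturality f
  rwa [Category.id_comp, Category.assoc, ← Category.assoc (T.η.app X), ← hnat, Category.assoc, hβ,
    Category.comp_id] at h

/-- For a Kock-Zöberlein monad on an order-enriched category, every left adjoint
morphism `f : X ⟶ Y` between Eilenberg–Moore `T`-algebras `(X, α)` and `(Y, β)` is a
`T`-algebra homomorphism: `β ∘ T f = f ∘ α`. -/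
theorem stmt4 {C : Type u} [Category.{v} C] (E : OrderEnrichment C) (T : Monad C)
    (hT : ∀ {X Y : C} {f g : X ⟶ Y}, E.le f g → E.le (T.map f) (T.map g))
    (hKZ : ∀ X : C, E.le (T.map (T.η.app X)) (T.η.app (T.obj X)))
    (X Y : C) (α : T.obj X ⟶ X) (β : T.obj Y ⟶ Y)
    (hα : T.η.app X ≫ α = 𝟙 X ∧ T.map α ≫ α = T.μ.app X ≫ α)
    (hβ : T.η.app Y ≫ β = 𝟙 Y ∧ T.map β ≫ β = T.μ.app Y ≫ β)
    (f : X ⟶ Y) (g : Y ⟶ X)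
    (hadj : E.le (𝟙 X) (f ≫ g) ∧ E.le (g ≫ f) (𝟙 Y)) :
    T.map f ≫ β = α ≫ f := by
  refine E.le_antisymm (E.map_comp_le_comp T hKZ hα.1 hβ.1 f) ?_
  have hunit : E.le α (T.map f ≫ T.map g ≫ α) := by
    have h := E.comp_le_comp_right α (hT hadj.1)
    rwa [T.map_id, Category.id_comp, T.map_comp, Category.assoc] at h
  have hlax : E.le (T.map f ≫ T.map g ≫ α) (T.map f ≫ β ≫ g) :=
    E.comp_le_comp_left _ (E.map_comp_le_comp T hKZ hβ.1 hα.1 g)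
  have hcounit := E.comp_le_comp_left (T.map f ≫ β) hadj.2
  rw [Category.comp_id] at hcounit
  have h := E.comp_le_comp_right f (E.le_trans hunit hlax)
  simp only [Category.assoc] at h hcounit
  exact E.le_trans h hcounit
end

section
/- Let T = (T, m, e) be a Kock-Zöberlein monad on an order-enriched category C that has equalisers, such that T sends regular monomorphisms to monomorphisms. Let X be a split T-algebra with t ⊣ α ⊣ e_X and let i : A → X be an equaliser of the pair e_X, t : X → TX. Then (X, α) is algebraic — isomorphic in the Eilenberg–Moore category to a free algebra (TY, m_Y) for some object Y — if and only if there exists i* : X → TA such that e_X ∘ i is left adjoint to i* in the Kleisli category (e_A ≤ m_A ∘ T(i*) ∘ e_X ∘ i and m_X ∘ T(e_X ∘ i) ∘ i* ≤ e_X) and T(i) ∘ i* = t. -/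
open CategoryTheory

universe v u

open CategoryTheory.Limits

/-- The algebra `(X, α)` is algebraic: isomorphic in the Eilenberg–Moore category to a free
algebra `(TY, m_Y)` for some object `Y`. -/
def IsAlgebraicAlgebra {C : Type u} [Category.{v} C] (T : Monad C)
    (X : C) (α : T.obj X ⟶ X) : Prop :=
  ∃ (Y : C) (f : T.obj Y ⟶ X) (g : X ⟶ T.obj Y),
    T.map f ≫ α = T.μ.app Y ≫ f ∧ f ≫ g = 𝟙 (T.obj Y) ∧ g ≫ f = 𝟙 X

namespace OrderEnrichment

variable {C : Type u} [Category.{v} C] (E : OrderEnrichment C)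

/-- `f` is left adjoint to `g` for the given order-enrichment. -/
structure Adj {X Y : C} (f : X ⟶ Y) (g : Y ⟶ X) : Prop where
  unit : E.le (𝟙 X) (f ≫ g)
  counit : E.le (g ≫ f) (𝟙 Y)

variable {E}

theorem Adj.comp {X Y Z : C} {f : X ⟶ Y} {g : Y ⟶ X} {f' : Y ⟶ Z} {g' : Z ⟶ Y}
    (h : E.Adj f g) (h' : E.Adj f' g') : E.Adj (f ≫ f') (g' ≫ g) where
  unit := E.le_trans h.unit (by
    simpa using E.comp_le_comp_left f (E.comp_le_comp_right g h'.unit))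
  counit := E.le_trans (by
    simpa using E.comp_le_comp_left g' (E.comp_le_comp_right f' h.counit)) h'.counit

theorem Adj.left_le {X Y : C} {f f' : X ⟶ Y} {g : Y ⟶ X}
    (h : E.Adj f g) (h' : E.Adj f' g) : E.le f f' := by
  have h₁ := E.comp_le_comp_right f h'.unit
  have h₂ := E.comp_le_comp_left f' h.counit
  simp only [Category.id_comp, Category.comp_id, Category.assoc] at h₁ h₂
  exact E.le_trans h₁ h₂

theorem Adj.left_unique {X Y : C} {f f' : X ⟶ Y} {g : Y ⟶ X}
    (h : E.Adj f g) (h' : E.Adj f' g) : f = f' :=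
  E.le_antisymm (h.left_le h') (h'.left_le h)

theorem adj_of_iso {X Y : C} {f : X ⟶ Y} {g : Y ⟶ X} (hfg : f ≫ g = 𝟙 X) (hgf : g ≫ f = 𝟙 Y) :
    E.Adj f g where
  unit := by rw [hfg]; exact E.le_refl _
  counit := by rw [hgf]; exact E.le_refl _

variable {T : Monad C}

theorem Adj.map
    (hT : ∀ {X Y : C} {f g : X ⟶ Y}, E.le f g → E.le (T.map f) (T.map g))
    {X Y : C} {f : X ⟶ Y} {g : Y ⟶ X} (h : E.Adj f g) :
    E.Adj (T.map f) (T.map g) where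
  unit := by simpa using hT h.unit
  counit := by simpa using hT h.counit

/-- For a Kock-Zöberlein monad, the multiplication is left adjoint to the unit. -/
theorem mu_adj_eta
    (hKZ : ∀ X : C, E.le (T.map (T.η.app X)) (T.η.app (T.obj X)))
    (X : C) : E.Adj (T.μ.app X) (T.η.app (T.obj X)) where
  unit := by
    have h := E.comp_le_comp_right (T.map (T.μ.app X)) (hKZ (T.obj X))
    have h₁ : T.map (T.η.app (T.obj X)) ≫ T.map (T.μ.app X) = 𝟙 _ := by
      rw [← T.map_comp, T.left_unit, T.map_id]
    have h₂ : T.η.app (T.obj (T.obj X)) ≫ T.map (T.μ.app X) =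
        T.μ.app X ≫ T.η.app (T.obj X) := (T.η.naturality (T.μ.app X)).symm
    rwa [h₁, h₂] at h
  counit := by rw [T.left_unit]; exact E.le_refl _

/-- For a Kock-Zöberlein monad, `T e` is left adjoint to the multiplication. -/
theorem map_eta_adj_mu
    (hT : ∀ {X Y : C} {f g : X ⟶ Y}, E.le f g → E.le (T.map f) (T.map g))
    (hKZ : ∀ X : C, E.le (T.map (T.η.app X)) (T.η.app (T.obj X)))
    (X : C) : E.Adj (T.map (T.η.app X)) (T.μ.app X) where
  unit := by rw [T.right_unit]; exact E.le_refl _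
  counit := by
    have h := E.comp_le_comp_right (T.μ.app (T.obj X)) (hT (hKZ X))
    have h₁ : T.map (T.map (T.η.app X)) ≫ T.μ.app (T.obj X) =
        T.μ.app X ≫ T.map (T.η.app X) := T.μ.naturality (T.η.app X)
    rwa [h₁, T.right_unit] at h

/-- The splitting of a split algebra of a Kock-Zöberlein monad is an algebra homomorphism. -/
theorem Adj.splitting_hom
    (hT : ∀ {X Y : C} {f g : X ⟶ Y}, E.le f g → E.le (T.map f) (T.map g))
    (hKZ : ∀ X : C, E.le (T.map (T.η.app X)) (T.η.app (T.obj X)))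
    {X : C} {α : T.obj X ⟶ X} {t : X ⟶ T.obj X}
    (htα : E.Adj t α) (hαe : E.Adj α (T.η.app X)) :
    α ≫ t = T.map t ≫ T.μ.app X := by
  have h := (htα.map hT).comp (mu_adj_eta hKZ X)
  have h₁ : T.η.app (T.obj X) ≫ T.map α = α ≫ T.η.app X := (T.η.naturality α).symm
  rw [h₁] at h
  exact (hαe.comp htα).left_unique h

end OrderEnrichment

/-- Let `T` be a Kock-Zöberlein monad on an order-enriched category with
equalisers such that `T` sends regular monos to monos, let `X` be a split `T`-algebra with
`t ⊣ α ⊣ e_X`, and let `i : A → X` be an equaliser of `e_X, t : X ⟶ TX`. Then `(X, α)` is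
algebraic iff there is `i* : X ⟶ TA` such that `e_X ∘ i ⊣ i*` in the Kleisli category and
`T i ∘ i* = t`. -/
theorem stmt10 {C : Type u} [Category.{v} C] (E : OrderEnrichment C) (T : Monad C)
    (hT : ∀ {X Y : C} {f g : X ⟶ Y}, E.le f g → E.le (T.map f) (T.map g))
    (hKZ : ∀ X : C, E.le (T.map (T.η.app X)) (T.η.app (T.obj X)))
    [HasEqualizers C]
    (hreg : ∀ {X Y : C} (f : X ⟶ Y), RegularMono f → Mono (T.map f))
    (X : C) (α : T.obj X ⟶ X) (t : X ⟶ T.obj X)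
    (halg : T.η.app X ≫ α = 𝟙 X ∧ T.map α ≫ α = T.μ.app X ≫ α)
    (hαe : E.le (𝟙 (T.obj X)) (α ≫ T.η.app X) ∧ E.le (T.η.app X ≫ α) (𝟙 X))
    (htα : E.le (𝟙 X) (t ≫ α) ∧ E.le (α ≫ t) (𝟙 (T.obj X)))
    (A : C) (i : A ⟶ X)
    (hfork : i ≫ T.η.app X = i ≫ t)
    (huniv : ∀ {W : C} (h : W ⟶ X), h ≫ T.η.app X = h ≫ t → ∃! k : W ⟶ A, k ≫ i = h) :
    IsAlgebraicAlgebra T X α ↔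
      ∃ istar : X ⟶ T.obj A,
        E.le (T.η.app A) ((i ≫ T.η.app X) ≫ T.map istar ≫ T.μ.app A) ∧
        E.le (istar ≫ T.map (i ≫ T.η.app X) ≫ T.μ.app X) (T.η.app X) ∧
        istar ≫ T.map i = t := by
  have adj_αe : E.Adj α (T.η.app X) := ⟨hαe.1, hαe.2⟩
  have adj_tα : E.Adj t α := ⟨htα.1, htα.2⟩
  have hte : E.le t (T.η.app X) := by
    have h := E.comp_le_comp_left (X := X) (T.η.app X) htα.2
    rwa [← Category.assoc, halg.1, Category.id_comp, Category.comp_id] at h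
  have mono_map_i : Mono (T.map i) := hreg i
    { Z := T.obj X
      left := T.η.app X
      right := t
      w := hfork
      isLimit := Fork.IsLimit.ofExistsUnique fun s => huniv s.ι s.condition }
  have kleisli_unit (j : X ⟶ T.obj A) :
      (i ≫ T.η.app X) ≫ T.map j ≫ T.μ.app A = i ≫ j := by
    have h : T.η.app X ≫ T.map j = j ≫ T.η.app (T.obj A) := (T.η.naturality j).symm
    rw [Category.assoc, reassoc_of% h, T.left_unit]
    exact congrArg (i ≫ ·) (Category.comp_id j)
  have kleisli_counit : T.map (i ≫ T.η.app X) ≫ T.μ.app X = T.map i := by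
    rw [T.map_comp, Category.assoc, T.right_unit]
    exact Category.comp_id (T.map i)
  have eta_i : T.η.app A ≫ T.map i = i ≫ T.η.app X := (T.η.naturality i).symm
  simp only [kleisli_unit, kleisli_counit]
  constructor
  · rintro ⟨Y, f, g, hf, hfg, hgf⟩
    have hα : T.map g ≫ T.μ.app Y ≫ f = α := by
      rw [← hf, ← Category.assoc, ← T.map_comp, hgf, T.map_id, Category.id_comp]
    have ht : t = (g ≫ T.map (T.η.app Y)) ≫ T.map f := by
      have h := ((OrderEnrichment.adj_of_iso (E := E) hgf hfg).comp
        (OrderEnrichment.map_eta_adj_mu hT hKZ Y)).comp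
        ((OrderEnrichment.adj_of_iso (E := E) hfg hgf).map hT)
      rw [hα] at h
      exact adj_tα.left_unique h
    have heq : (T.η.app Y ≫ f) ≫ T.η.app X = (T.η.app Y ≫ f) ≫ t := by
      have h₁ : f ≫ T.η.app X = T.η.app (T.obj Y) ≫ T.map f := T.η.naturality f
      have h₂ : T.η.app Y ≫ T.η.app (T.obj Y) = T.η.app Y ≫ T.map (T.η.app Y) :=
        T.η.naturality (T.η.app Y)
      simp only [ht, Category.assoc, h₁, reassoc_of% hfg, reassoc_of% h₂]
    obtain ⟨k, hk, -⟩ := huniv _ heq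
    have hstar : (g ≫ T.map k) ≫ T.map i = t := by
      rw [Category.assoc, ← T.map_comp, hk, T.map_comp, ht, Category.assoc]
    refine ⟨g ≫ T.map k, ?_, ?_, hstar⟩
    · have h : T.η.app A = i ≫ g ≫ T.map k := by
        rw [← cancel_mono (T.map i), eta_i, hfork, Category.assoc, hstar]
      rw [← h]
      exact E.le_refl _
    · rwa [hstar]
  · rintro ⟨j, -, -, hj⟩
    refine ⟨A, T.map i ≫ α, j, ?_, ?_, ?_⟩
    · have h : T.map (T.map i) ≫ T.μ.app X = T.μ.app A ≫ T.map i := T.μ.naturality i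
      rw [T.map_comp, Category.assoc, halg.2, reassoc_of% h]
    · rw [← cancel_mono (T.map i), Category.assoc, Category.assoc, hj,
        adj_tα.splitting_hom hT hKZ adj_αe, ← Category.assoc, ← T.map_comp, ← hfork,
        kleisli_counit, Category.id_comp]
    · rw [← Category.assoc, hj]
      refine E.le_antisymm ?_ htα.1
      rw [← halg.1]
      exact E.comp_le_comp_right α hte
end
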